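/- Let Ω ⊆ ℝ² be open, T > 0, H > 0, and let Ū₀, f, N be real constants with N ≠ 0. Fix an integer M ≥ 1 and continuously differentiable functions u_m, v_m, φ_m : Ω × (0, T) → ℝ for 0 ≤ m ≤ M and w_m, ψ_m : Ω × (0, T) → ℝ for 1 ≤ m ≤ M. Define u(x,y,z,t) = Σ_{m=0}^M U_m(z)·u_m(x,y,t), v = Σ_{m=0}^M U_m·v_m, φ = Σ_{m=0}^M U_m·φ_m, w = Σ_{m=1}^M W_m·w_m, ψ = Σ_{m=1}^M W_m·ψ_m. Assume that at every (x,y,t) ∈ Ω × (0,T) and z ∈ (−H, 0) these functions satisfy the primitive equations: u_t + Ū₀u_x + φ_x − fv + (uu_x + vu_y + wu_z) = 0, v_t + Ū₀v_x + φ_y + fu + (uv_x + vv_y + wv_z) + fŪ₀ = 0, ψ_t + Ū₀ψ_x + N²w + (uψ_x + vψ_y + wψ_z) = 0, u_x + v_y + w_z = 0, and φ_z = ψ. Then for every integer 1 ≤ n ≤ M and every (x,y,t) ∈ Ω × (0,T): φ_n = −ψ_n/λ_n; w_n = −(∂u_n/∂x + ∂v_n/∂y)/λ_n; ∂u_n/∂t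 + Ū₀·∂u_n/∂x + ∂φ_n/∂x − f·v_n + ∫_{−H}^0 (uu_x + vu_y + wu_z)·U_n(z) dz = 0; ∂v_n/∂t + Ū₀·∂v_n/∂x + ∂φ_n/∂y + f·u_n + ∫_{−H}^0 (uv_x + vv_y + wv_z)·U_n(z) dz = 0; and ∂ψ_n/∂t + Ū₀·∂ψ_n/∂x − (N²/λ_n)·(∂u_n/∂x + ∂v_n/∂y) + ∫_{−H}^0 (uψ_x + vψ_y + wψ_z)·W_n(z) dz = 0. -/

import Mathlib

/-- The eigenvalue `λ_n = nπ/H`. -/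
noncomputable def lamC (H : ℝ) (n : ℕ) : ℝ := n * Real.pi / H

/-- The cosine normal-mode eigenfunctions: `U_0(z) = 1/√H`,
`U_n(z) = √(2/H)·cos(λ_n z)` for `n ≥ 1`. -/
noncomputable def Ue (H : ℝ) (n : ℕ) (z : ℝ) : ℝ :=
  if n = 0 then 1 / Real.sqrt H else Real.sqrt (2 / H) * Real.cos (lamC H n * z)

/-- The sine normal-mode eigenfunctions: `W_n(z) = √(2/H)·sin(λ_n z)`. -/
noncomputable def We (H : ℝ) (n : ℕ) (z : ℝ) : ℝ :=
  Real.sqrt (2 / H) * Real.sin (lamC H n * z)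

/-- Partial derivative in `x` of a function of `(x, y, t)`. -/
noncomputable def px (f : ℝ × ℝ × ℝ → ℝ) (q : ℝ × ℝ × ℝ) : ℝ :=
  deriv (fun x => f (x, q.2.1, q.2.2)) q.1

/-- Partial derivative in `y` of a function of `(x, y, t)`. -/
noncomputable def py (f : ℝ × ℝ × ℝ → ℝ) (q : ℝ × ℝ × ℝ) : ℝ :=
  deriv (fun y => f (q.1, y, q.2.2)) q.2.1

/-- Partial derivative in `t` of a function of `(x, y, t)`. -/
noncomputable def pt (f : ℝ × ℝ × ℝ → ℝ) (q : ℝ × ℝ × ℝ) : ℝ :=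
  deriv (fun t => f (q.1, q.2.1, t)) q.2.2

/-- Partial derivative in `x` of a function of `(x, y, z, t)`. -/
noncomputable def pX (f : ℝ × ℝ × ℝ × ℝ → ℝ) (p : ℝ × ℝ × ℝ × ℝ) : ℝ :=
  deriv (fun x => f (x, p.2.1, p.2.2.1, p.2.2.2)) p.1

/-- Partial derivative in `y` of a function of `(x, y, z, t)`. -/
noncomputable def pY (f : ℝ × ℝ × ℝ × ℝ → ℝ) (p : ℝ × ℝ × ℝ × ℝ) : ℝ :=
  deriv (fun y => f (p.1, y, p.2.2.1, p.2.2.2)) p.2.1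

/-- Partial derivative in `z` of a function of `(x, y, z, t)`. -/
noncomputable def pZ (f : ℝ × ℝ × ℝ × ℝ → ℝ) (p : ℝ × ℝ × ℝ × ℝ) : ℝ :=
  deriv (fun z => f (p.1, p.2.1, z, p.2.2.2)) p.2.2.1

/-- Partial derivative in `t` of a function of `(x, y, z, t)`. -/
noncomputable def pT (f : ℝ × ℝ × ℝ × ℝ → ℝ) (p : ℝ × ℝ × ℝ × ℝ) : ℝ :=
  deriv (fun t => f (p.1, p.2.1, p.2.2.1, t)) p.2.2.2

/-- The finite normal-mode cosine expansion `Σ_{m=0}^M U_m(z)·c_m(x,y,t)`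
as a function of `(x, y, z, t)`. -/
noncomputable def cosExp4 (H : ℝ) (M : ℕ) (c : ℕ → ℝ × ℝ × ℝ → ℝ)
    (p : ℝ × ℝ × ℝ × ℝ) : ℝ :=
  ∑ m ∈ Finset.range (M + 1), Ue H m p.2.2.1 * c m (p.1, p.2.1, p.2.2.2)

/-- The finite normal-mode sine expansion `Σ_{m=1}^M W_m(z)·c_m(x,y,t)`
as a function of `(x, y, z, t)`. -/
noncomputable def sinExp4 (H : ℝ) (M : ℕ) (c : ℕ → ℝ × ℝ × ℝ → ℝ)
    (p : ℝ × ℝ × ℝ × ℝ) : ℝ :=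
  ∑ m ∈ Finset.Icc 1 M, We H m p.2.2.1 * c m (p.1, p.2.1, p.2.2.2)

lemma int_cos_k (H : ℝ) (hH : 0 < H) (k : ℤ) :
    ∫ z in (-H)..0, Real.cos ((k * Real.pi / H) * z) = if k = 0 then H else 0 := by
  split_ifs with h
  · subst h; simp
  · have hk : (k * Real.pi / H : ℝ) ≠ 0 := by
      have : (k : ℝ) ≠ 0 := by exact_mod_cast h
      have := Real.pi_ne_zero
      positivity
    rw [intervalIntegral.integral_comp_mul_left _ hk, integral_cos]
    have : (k * Real.pi / H : ℝ) * -H = -(k * Real.pi) := by field_simp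
    rw [this]
    simp [Real.sin_neg, Real.sin_int_mul_pi]

lemma Ue_pos (H : ℝ) (n : ℕ) (hn : 1 ≤ n) (z : ℝ) :
    Ue H n z = Real.sqrt (2 / H) * Real.cos (lamC H n * z) := by
  simp [Ue, show n ≠ 0 by omega]

lemma Ue_cont (H : ℝ) (n : ℕ) : Continuous (Ue H n) := by
  unfold Ue
  split_ifs <;> fun_prop

lemma We_cont (H : ℝ) (n : ℕ) : Continuous (We H n) := by
  unfold We
  fun_prop

lemma Ue_int (H : ℝ) (hH : 0 < H) (n : ℕ) (hn : 1 ≤ n) : ∫ z in (-H)..0, Ue H n z = 0 := by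
  simp_rw [Ue_pos H n hn]
  rw [intervalIntegral.integral_const_mul]
  have := int_cos_k H hH n
  simp only [Int.cast_natCast, Int.natCast_eq_zero, show n ≠ 0 by omega, if_false] at this
  simp [lamC, this]

lemma prod_int (H : ℝ) (hH : 0 < H) (s : ℝ) (m n : ℕ) (hm : 1 ≤ m) (hn : 1 ≤ n) :
    ∫ z in (-H)..0, (1 / H) * (Real.cos ((((m : ℤ) - n : ℤ) * Real.pi / H) * z)
      + s * Real.cos ((((m : ℤ) + n : ℤ) * Real.pi / H) * z)) = if m = n then 1 else 0 := by
  rw [intervalIntegral.integral_const_mul, intervalIntegral.integral_add,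
    intervalIntegral.integral_const_mul, int_cos_k H hH, int_cos_k H hH]
  · rw [if_neg (show ¬ ((m : ℤ) + n = 0) by omega)]
    by_cases h : m = n
    · simp [h]; field_simp
    · rw [if_neg (by omega), if_neg h]; simp
  · exact Continuous.intervalIntegrable (by fun_prop) _ _
  · exact Continuous.intervalIntegrable (by fun_prop) _ _

lemma UU_int (H : ℝ) (hH : 0 < H) (m n : ℕ) (hn : 1 ≤ n) :
    ∫ z in (-H)..0, Ue H m z * Ue H n z = if m = n then 1 else 0 := by
  rcases Nat.eq_zero_or_pos m with rfl | hm
  · have : ∀ z, Ue H 0 z = 1 / Real.sqrt H := fun z => by simp [Ue]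
    simp_rw [this]
    rw [intervalIntegral.integral_const_mul, Ue_int H hH n hn, if_neg (by omega)]
    simp
  · rw [← prod_int H hH 1 m n hm hn]
    congr 1; ext z
    have h2 : Real.sqrt (2 / H) * Real.sqrt (2 / H) = 2 / H := Real.mul_self_sqrt (by positivity)
    rw [Ue_pos H m hm, Ue_pos H n hn]
    have e1 : ((((m : ℤ) - n : ℤ) : ℝ) * Real.pi / H) * z = lamC H m * z - lamC H n * z := by
      simp only [lamC]; push_cast; ring
    have e2 : ((((m : ℤ) + n : ℤ) : ℝ) * Real.pi / H) * z = lamC H m * z + lamC H n * z := by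
      simp only [lamC]; push_cast; ring
    rw [e1, e2, Real.cos_sub, Real.cos_add]
    linear_combination (Real.cos (lamC H m * z) * Real.cos (lamC H n * z)) * h2

lemma WW_int (H : ℝ) (hH : 0 < H) (m n : ℕ) (hm : 1 ≤ m) (hn : 1 ≤ n) :
    ∫ z in (-H)..0, We H m z * We H n z = if m = n then 1 else 0 := by
  rw [← prod_int H hH (-1) m n hm hn]
  congr 1; ext z
  have h2 : Real.sqrt (2 / H) * Real.sqrt (2 / H) = 2 / H := Real.mul_self_sqrt (by positivity)
  have e1 : ((((m : ℤ) - n : ℤ) : ℝ) * Real.pi / H) * z = lamC H m * z - lamC H n * z := by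
    simp only [lamC]; push_cast; ring
  have e2 : ((((m : ℤ) + n : ℤ) : ℝ) * Real.pi / H) * z = lamC H m * z + lamC H n * z := by
    simp only [lamC]; push_cast; ring
  rw [e1, e2, Real.cos_sub, Real.cos_add]
  simp only [We]
  linear_combination (Real.sin (lamC H m * z) * Real.sin (lamC H n * z)) * h2

/-- Projection of a function that is a cosine expansion plus a constant. -/
lemma proj_cos (H : ℝ) (hH : 0 < H) (M n : ℕ) (hn : 1 ≤ n) (hM : n ≤ M)
    (c : ℕ → ℝ × ℝ × ℝ → ℝ) (x y t k : ℝ) (g : ℝ → ℝ)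
    (hg : ∀ z ∈ Set.Ioo (-H) 0, g z = cosExp4 H M c (x, y, z, t) + k) :
    ∫ z in (-H)..0, g z * Ue H n z = c n (x, y, t) := by
  have h1 : ∫ z in (-H)..0, g z * Ue H n z
      = ∫ z in (-H)..0, ((∑ m ∈ Finset.range (M + 1), c m (x, y, t) * (Ue H m z * Ue H n z))
        + k * Ue H n z) := by
    rw [intervalIntegral.integral_of_le (by linarith), intervalIntegral.integral_of_le (by linarith),
      MeasureTheory.integral_Ioc_eq_integral_Ioo, MeasureTheory.integral_Ioc_eq_integral_Ioo]
    refine MeasureTheory.setIntegral_congr_fun measurableSet_Ioo fun z hz => ?_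
    simp only [hg z hz, cosExp4, add_mul, Finset.sum_mul]
    congr 1
    exact Finset.sum_congr rfl fun m _ => by ring
  have hc := Ue_cont H
  rw [h1, intervalIntegral.integral_add, intervalIntegral.integral_const_mul, Ue_int H hH n hn,
    intervalIntegral.integral_finsetSum]
  · simp_rw [intervalIntegral.integral_const_mul, UU_int H hH _ n hn]
    simp [show n < M + 1 by omega]
  · intro m _
    exact Continuous.intervalIntegrable (by fun_prop) _ _
  · exact Continuous.intervalIntegrable (by fun_prop) _ _
  · exact Continuous.intervalIntegrable (by fun_prop) _ _

lemma proj_sin (H : ℝ) (hH : 0 < H) (M n : ℕ) (hn : 1 ≤ n) (hM : n ≤ M)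
    (c : ℕ → ℝ × ℝ × ℝ → ℝ) (x y t : ℝ) (g : ℝ → ℝ)
    (hg : ∀ z ∈ Set.Ioo (-H) 0, g z = sinExp4 H M c (x, y, z, t)) :
    ∫ z in (-H)..0, g z * We H n z = c n (x, y, t) := by
  have h1 : ∫ z in (-H)..0, g z * We H n z
      = ∫ z in (-H)..0, (∑ m ∈ Finset.Icc 1 M, c m (x, y, t) * (We H m z * We H n z)) := by
    rw [intervalIntegral.integral_of_le (by linarith), intervalIntegral.integral_of_le (by linarith),
      MeasureTheory.integral_Ioc_eq_integral_Ioo, MeasureTheory.integral_Ioc_eq_integral_Ioo]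
    refine MeasureTheory.setIntegral_congr_fun measurableSet_Ioo fun z hz => ?_
    simp only [hg z hz, sinExp4, Finset.sum_mul]
    exact Finset.sum_congr rfl fun m _ => by ring
  have hc := We_cont H
  rw [h1, intervalIntegral.integral_finsetSum]
  · have : ∀ m ∈ Finset.Icc 1 M, ∫ z in (-H)..0, c m (x, y, t) * (We H m z * We H n z)
        = if m = n then c m (x, y, t) else 0 := by
      intro m hm
      rw [intervalIntegral.integral_const_mul, WW_int H hH m n (Finset.mem_Icc.1 hm).1 hn]
      simp
    rw [Finset.sum_congr rfl this]
    simp [hn, hM]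
  · intro m _
    exact Continuous.intervalIntegrable (by fun_prop) _ _

lemma cos_add (H : ℝ) (M : ℕ) (a b : ℕ → ℝ × ℝ × ℝ → ℝ) (p : ℝ × ℝ × ℝ × ℝ) :
    cosExp4 H M a p + cosExp4 H M b p = cosExp4 H M (fun m q => a m q + b m q) p := by
  simp only [cosExp4, ← Finset.sum_add_distrib, mul_add]

lemma cos_smul (H : ℝ) (M : ℕ) (k : ℝ) (b : ℕ → ℝ × ℝ × ℝ → ℝ) (p : ℝ × ℝ × ℝ × ℝ) :
    k * cosExp4 H M b p = cosExp4 H M (fun m q => k * b m q) p := by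
  simp only [cosExp4, Finset.mul_sum, mul_left_comm]

lemma sin_add (H : ℝ) (M : ℕ) (a b : ℕ → ℝ × ℝ × ℝ → ℝ) (p : ℝ × ℝ × ℝ × ℝ) :
    sinExp4 H M a p + sinExp4 H M b p = sinExp4 H M (fun m q => a m q + b m q) p := by
  simp only [sinExp4, ← Finset.sum_add_distrib, mul_add]

lemma sin_smul (H : ℝ) (M : ℕ) (k : ℝ) (b : ℕ → ℝ × ℝ × ℝ → ℝ) (p : ℝ × ℝ × ℝ × ℝ) :
    k * sinExp4 H M b p = sinExp4 H M (fun m q => k * b m q) p := by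
  simp only [sinExp4, Finset.mul_sum, mul_left_comm]

lemma Ue_deriv (H : ℝ) (m : ℕ) (z : ℝ) : HasDerivAt (Ue H m) (-lamC H m * We H m z) z := by
  rcases Nat.eq_zero_or_pos m with rfl | hm
  · have : Ue H 0 = fun _ => 1 / Real.sqrt H := by ext z; simp [Ue]
    rw [this]
    simpa [lamC] using hasDerivAt_const z (1 / Real.sqrt H)
  · have : Ue H m = fun z => Real.sqrt (2 / H) * Real.cos (lamC H m * z) := by
      ext z; exact Ue_pos H m hm z
    rw [this]
    have h0 : HasDerivAt (fun z => lamC H m * z) (lamC H m * 1) z :=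
      (hasDerivAt_id' z).const_mul (lamC H m)
    refine (h0.cos.const_mul (Real.sqrt (2 / H))).congr_deriv ?_
    simp only [We]; ring

lemma We_deriv (H : ℝ) (m : ℕ) (hm : 1 ≤ m) (z : ℝ) :
    HasDerivAt (We H m) (lamC H m * Ue H m z) z := by
  unfold We
  rw [Ue_pos H m hm]
  have h0 : HasDerivAt (fun z => lamC H m * z) (lamC H m * 1) z :=
    (hasDerivAt_id' z).const_mul (lamC H m)
  refine (h0.sin.const_mul (Real.sqrt (2 / H))).congr_deriv ?_
  ring

lemma pZ_cos (H : ℝ) (M : ℕ) (c : ℕ → ℝ × ℝ × ℝ → ℝ) (p : ℝ × ℝ × ℝ × ℝ) :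
    pZ (cosExp4 H M c) p = sinExp4 H M (fun m q => -lamC H m * c m q) p := by
  have h : HasDerivAt (fun z => cosExp4 H M c (p.1, p.2.1, z, p.2.2.2))
      (∑ m ∈ Finset.range (M + 1), (-lamC H m * We H m p.2.2.1) * c m (p.1, p.2.1, p.2.2.2))
      p.2.2.1 := by
    unfold cosExp4
    exact HasDerivAt.fun_sum fun m _ => (Ue_deriv H m p.2.2.1).mul_const (c m (p.1, p.2.1, p.2.2.2))
  rw [pZ, h.deriv, sinExp4, Finset.range_eq_Ico, Finset.sum_eq_sum_Ico_succ_bot (by omega)]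
  simp only [lamC, Nat.cast_zero, zero_mul, zero_div, neg_zero, zero_add]
  exact Finset.sum_congr rfl fun m _ => by ring

lemma pZ_sin (H : ℝ) (M : ℕ) (c : ℕ → ℝ × ℝ × ℝ → ℝ) (p : ℝ × ℝ × ℝ × ℝ) :
    pZ (sinExp4 H M c) p = cosExp4 H M (fun m q => lamC H m * c m q) p := by
  have h : HasDerivAt (fun z => sinExp4 H M c (p.1, p.2.1, z, p.2.2.2))
      (∑ m ∈ Finset.Icc 1 M, (lamC H m * Ue H m p.2.2.1) * c m (p.1, p.2.1, p.2.2.2))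
      p.2.2.1 := by
    unfold sinExp4
    exact HasDerivAt.fun_sum fun m hm =>
      (We_deriv H m (Finset.mem_Icc.1 hm).1 p.2.2.1).mul_const (c m (p.1, p.2.1, p.2.2.2))
  rw [pZ, h.deriv, cosExp4, Finset.range_eq_Ico, Finset.sum_eq_sum_Ico_succ_bot (by omega)]
  simp only [lamC, Nat.cast_zero, zero_mul, zero_div, zero_add, mul_zero]
  exact Finset.sum_congr rfl fun m _ => by ring

section partials
variable {H : ℝ} {M : ℕ} {c : ℕ → ℝ × ℝ × ℝ → ℝ} {p : ℝ × ℝ × ℝ × ℝ}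

lemma dx_aux {g : ℝ × ℝ × ℝ → ℝ} {q : ℝ × ℝ × ℝ} (h : DifferentiableAt ℝ g q) :
    DifferentiableAt ℝ (fun x => g (x, q.2.1, q.2.2)) q.1 :=
  DifferentiableAt.comp (g := g) (f := fun x : ℝ => (x, q.2.1, q.2.2)) q.1 h (by fun_prop)

lemma dy_aux {g : ℝ × ℝ × ℝ → ℝ} {q : ℝ × ℝ × ℝ} (h : DifferentiableAt ℝ g q) :
    DifferentiableAt ℝ (fun y => g (q.1, y, q.2.2)) q.2.1 :=
  DifferentiableAt.comp (g := g) (f := fun y : ℝ => (q.1, y, q.2.2)) q.2.1 h (by fun_prop)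

lemma dt_aux {g : ℝ × ℝ × ℝ → ℝ} {q : ℝ × ℝ × ℝ} (h : DifferentiableAt ℝ g q) :
    DifferentiableAt ℝ (fun t => g (q.1, q.2.1, t)) q.2.2 :=
  DifferentiableAt.comp (g := g) (f := fun t : ℝ => (q.1, q.2.1, t)) q.2.2 h (by fun_prop)

lemma pX_cos (h : ∀ m ≤ M, DifferentiableAt ℝ (c m) (p.1, p.2.1, p.2.2.2)) :
    pX (cosExp4 H M c) p = cosExp4 H M (fun m => px (c m)) p :=
  (HasDerivAt.fun_sum fun m hm => (dx_aux (h m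
    (by have := Finset.mem_range.1 hm; omega))).hasDerivAt.const_mul (Ue H m p.2.2.1)).deriv

lemma pY_cos (h : ∀ m ≤ M, DifferentiableAt ℝ (c m) (p.1, p.2.1, p.2.2.2)) :
    pY (cosExp4 H M c) p = cosExp4 H M (fun m => py (c m)) p :=
  (HasDerivAt.fun_sum fun m hm => (dy_aux (h m
    (by have := Finset.mem_range.1 hm; omega))).hasDerivAt.const_mul (Ue H m p.2.2.1)).deriv

lemma pT_cos (h : ∀ m ≤ M, DifferentiableAt ℝ (c m) (p.1, p.2.1, p.2.2.2)) :
    pT (cosExp4 H M c) p = cosExp4 H M (fun m => pt (c m)) p :=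
  (HasDerivAt.fun_sum fun m hm => (dt_aux (h m
    (by have := Finset.mem_range.1 hm; omega))).hasDerivAt.const_mul (Ue H m p.2.2.1)).deriv

lemma pX_sin (h : ∀ m, 1 ≤ m → m ≤ M → DifferentiableAt ℝ (c m) (p.1, p.2.1, p.2.2.2)) :
    pX (sinExp4 H M c) p = sinExp4 H M (fun m => px (c m)) p :=
  (HasDerivAt.fun_sum fun m hm => (dx_aux (h m (Finset.mem_Icc.1 hm).1
    (Finset.mem_Icc.1 hm).2)).hasDerivAt.const_mul (We H m p.2.2.1)).deriv

lemma pT_sin (h : ∀ m, 1 ≤ m → m ≤ M → DifferentiableAt ℝ (c m) (p.1, p.2.1, p.2.2.2)) :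
    pT (sinExp4 H M c) p = sinExp4 H M (fun m => pt (c m)) p :=
  (HasDerivAt.fun_sum fun m hm => (dt_aux (h m (Finset.mem_Icc.1 hm).1
    (Finset.mem_Icc.1 hm).2)).hasDerivAt.const_mul (We H m p.2.2.1)).deriv

end partials

/-- Projection of the 3D inviscid primitive equations onto the baroclinic mode `n ≥ 1`:
if the finite normal-mode expansions `u = Σ U_m u_m`, `v = Σ U_m v_m`, `φ = Σ U_m φ_m`,
`w = Σ W_m w_m`, `ψ = Σ W_m ψ_m` solve the primitive equations on `Ω × (−H,0) × (0,T)`,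
then for each `1 ≤ n ≤ M` the mode-`n` coefficients satisfy the diagnostic relations
`φ_n = −ψ_n/λ_n`, `w_n = −(∂u_n/∂x + ∂v_n/∂y)/λ_n` and the projected prognostic system. -/
theorem baroclinic_mode_projection
    (Ω : Set (ℝ × ℝ)) (hΩ : IsOpen Ω) (T H : ℝ) (hT : 0 < T) (hH : 0 < H)
    (U0 f N : ℝ) (hN : N ≠ 0) (M : ℕ) (hM : 1 ≤ M)
    (um vm pm wm ψm : ℕ → ℝ × ℝ × ℝ → ℝ)
    (hum : ∀ m ≤ M, ContDiffOn ℝ 1 (um m)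
      {q : ℝ × ℝ × ℝ | (q.1, q.2.1) ∈ Ω ∧ q.2.2 ∈ Set.Ioo 0 T})
    (hvm : ∀ m ≤ M, ContDiffOn ℝ 1 (vm m)
      {q : ℝ × ℝ × ℝ | (q.1, q.2.1) ∈ Ω ∧ q.2.2 ∈ Set.Ioo 0 T})
    (hpm : ∀ m ≤ M, ContDiffOn ℝ 1 (pm m)
      {q : ℝ × ℝ × ℝ | (q.1, q.2.1) ∈ Ω ∧ q.2.2 ∈ Set.Ioo 0 T})
    (hwm : ∀ m, 1 ≤ m → m ≤ M → ContDiffOn ℝ 1 (wm m)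
      {q : ℝ × ℝ × ℝ | (q.1, q.2.1) ∈ Ω ∧ q.2.2 ∈ Set.Ioo 0 T})
    (hψm : ∀ m, 1 ≤ m → m ≤ M → ContDiffOn ℝ 1 (ψm m)
      {q : ℝ × ℝ × ℝ | (q.1, q.2.1) ∈ Ω ∧ q.2.2 ∈ Set.Ioo 0 T})
    (heq1 : ∀ p : ℝ × ℝ × ℝ × ℝ, (p.1, p.2.1) ∈ Ω → p.2.2.2 ∈ Set.Ioo 0 T →
      p.2.2.1 ∈ Set.Ioo (-H) 0 →
      pT (cosExp4 H M um) p + U0 * pX (cosExp4 H M um) p + pX (cosExp4 H M pm) p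
        - f * cosExp4 H M vm p
        + (cosExp4 H M um p * pX (cosExp4 H M um) p
            + cosExp4 H M vm p * pY (cosExp4 H M um) p
            + sinExp4 H M wm p * pZ (cosExp4 H M um) p) = 0)
    (heq2 : ∀ p : ℝ × ℝ × ℝ × ℝ, (p.1, p.2.1) ∈ Ω → p.2.2.2 ∈ Set.Ioo 0 T →
      p.2.2.1 ∈ Set.Ioo (-H) 0 →
      pT (cosExp4 H M vm) p + U0 * pX (cosExp4 H M vm) p + pY (cosExp4 H M pm) p
        + f * cosExp4 H M um p
        + (cosExp4 H M um p * pX (cosExp4 H M vm) p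
            + cosExp4 H M vm p * pY (cosExp4 H M vm) p
            + sinExp4 H M wm p * pZ (cosExp4 H M vm) p)
        + f * U0 = 0)
    (heq3 : ∀ p : ℝ × ℝ × ℝ × ℝ, (p.1, p.2.1) ∈ Ω → p.2.2.2 ∈ Set.Ioo 0 T →
      p.2.2.1 ∈ Set.Ioo (-H) 0 →
      pT (sinExp4 H M ψm) p + U0 * pX (sinExp4 H M ψm) p + N ^ 2 * sinExp4 H M wm p
        + (cosExp4 H M um p * pX (sinExp4 H M ψm) p
            + cosExp4 H M vm p * pY (sinExp4 H M ψm) p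
            + sinExp4 H M wm p * pZ (sinExp4 H M ψm) p) = 0)
    (heq4 : ∀ p : ℝ × ℝ × ℝ × ℝ, (p.1, p.2.1) ∈ Ω → p.2.2.2 ∈ Set.Ioo 0 T →
      p.2.2.1 ∈ Set.Ioo (-H) 0 →
      pX (cosExp4 H M um) p + pY (cosExp4 H M vm) p + pZ (sinExp4 H M wm) p = 0)
    (heq5 : ∀ p : ℝ × ℝ × ℝ × ℝ, (p.1, p.2.1) ∈ Ω → p.2.2.2 ∈ Set.Ioo 0 T →
      p.2.2.1 ∈ Set.Ioo (-H) 0 →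
      pZ (cosExp4 H M pm) p = sinExp4 H M ψm p) :
    ∀ n : ℕ, 1 ≤ n → n ≤ M →
    ∀ q : ℝ × ℝ × ℝ, (q.1, q.2.1) ∈ Ω → q.2.2 ∈ Set.Ioo 0 T →
      (pm n q = -ψm n q / lamC H n)
      ∧ (wm n q = -(px (um n) q + py (vm n) q) / lamC H n)
      ∧ (pt (um n) q + U0 * px (um n) q + px (pm n) q - f * vm n q
        + (∫ z in (-H)..0,
            (cosExp4 H M um (q.1, q.2.1, z, q.2.2) * pX (cosExp4 H M um) (q.1, q.2.1, z, q.2.2)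
              + cosExp4 H M vm (q.1, q.2.1, z, q.2.2) * pY (cosExp4 H M um) (q.1, q.2.1, z, q.2.2)
              + sinExp4 H M wm (q.1, q.2.1, z, q.2.2) * pZ (cosExp4 H M um) (q.1, q.2.1, z, q.2.2))
            * Ue H n z) = 0)
      ∧ (pt (vm n) q + U0 * px (vm n) q + py (pm n) q + f * um n q
        + (∫ z in (-H)..0,
            (cosExp4 H M um (q.1, q.2.1, z, q.2.2) * pX (cosExp4 H M vm) (q.1, q.2.1, z, q.2.2)
              + cosExp4 H M vm (q.1, q.2.1, z, q.2.2) * pY (cosExp4 H M vm) (q.1, q.2.1, z, q.2.2)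
              + sinExp4 H M wm (q.1, q.2.1, z, q.2.2) * pZ (cosExp4 H M vm) (q.1, q.2.1, z, q.2.2))
            * Ue H n z) = 0)
      ∧ (pt (ψm n) q + U0 * px (ψm n) q
        - (N ^ 2 / lamC H n) * (px (um n) q + py (vm n) q)
        + (∫ z in (-H)..0,
            (cosExp4 H M um (q.1, q.2.1, z, q.2.2) * pX (sinExp4 H M ψm) (q.1, q.2.1, z, q.2.2)
              + cosExp4 H M vm (q.1, q.2.1, z, q.2.2) * pY (sinExp4 H M ψm) (q.1, q.2.1, z, q.2.2)
              + sinExp4 H M wm (q.1, q.2.1, z, q.2.2) * pZ (sinExp4 H M ψm) (q.1, q.2.1, z, q.2.2))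
            * We H n z) = 0) := by
  intro n hn hnM q hq ht
  obtain ⟨x, y, t⟩ := q
  dsimp only at hq ht
  have hopen : IsOpen {q : ℝ × ℝ × ℝ | (q.1, q.2.1) ∈ Ω ∧ q.2.2 ∈ Set.Ioo 0 T} :=
    (hΩ.preimage (f := fun q : ℝ × ℝ × ℝ => (q.1, q.2.1)) (by fun_prop)).inter
      (isOpen_Ioo.preimage (f := fun q : ℝ × ℝ × ℝ => q.2.2) (by fun_prop))
  have key : ∀ g : ℝ × ℝ × ℝ → ℝ, ContDiffOn ℝ 1 g
      {q : ℝ × ℝ × ℝ | (q.1, q.2.1) ∈ Ω ∧ q.2.2 ∈ Set.Ioo 0 T} →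
      DifferentiableAt ℝ g (x, y, t) := fun g hg =>
    (hg.differentiableOn one_ne_zero).differentiableAt (hopen.mem_nhds ⟨hq, ht⟩)
  have du := fun m hm => key _ (hum m hm)
  have dv := fun m hm => key _ (hvm m hm)
  have dp := fun m hm => key _ (hpm m hm)
  have dψ := fun m h1 hm => key _ (hψm m h1 hm)
  have hl : lamC H n ≠ 0 := by
    have : (n : ℝ) ≠ 0 := by exact_mod_cast (show n ≠ 0 by omega)
    have := Real.pi_ne_zero
    have := hH.ne'
    unfold lamC
    positivity
  have hp : -lamC H n * pm n (x, y, t) = ψm n (x, y, t) := by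
    have a := proj_sin H hH M n hn hnM (fun m q => -lamC H m * pm m q) x y t
      (fun z => sinExp4 H M ψm (x, y, z, t)) (fun z hz => by
        rw [← heq5 (x, y, z, t) hq ht hz, pZ_cos])
    rw [← a]
    exact proj_sin H hH M n hn hnM ψm x y t _ fun z hz => rfl
  have hw : px (um n) (x, y, t) + py (vm n) (x, y, t) + lamC H n * wm n (x, y, t) = 0 := by
    have a := proj_cos H hH M n hn hnM
      (fun m q => px (um m) q + py (vm m) q + lamC H m * wm m q) x y t 0
      (fun z => 0) (fun z hz => by
        have h := heq4 (x, y, z, t) hq ht hz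
        rw [pX_cos du, pY_cos dv, pZ_sin, cos_add, cos_add] at h
        rw [h, add_zero])
    simpa using a.symm
  have hw' : wm n (x, y, t) = -(px (um n) (x, y, t) + py (vm n) (x, y, t)) / lamC H n := by
    field_simp
    linarith
  refine ⟨?_, hw', ?_, ?_, ?_⟩
  · rw [← hp]; field_simp
  · rw [proj_cos H hH M n hn hnM (fun m q => (-1) * (pt (um m) q + U0 * px (um m) q + px (pm m) q
      + (-f) * vm m q)) x y t 0]
    · ring
    · intro z hz
      have h := heq1 (x, y, z, t) hq ht hz
      rw [← cos_smul, ← cos_add, ← cos_add, ← cos_add, ← cos_smul, ← cos_smul,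
        ← pT_cos du, ← pX_cos du, ← pX_cos dp]
      linarith
  · rw [proj_cos H hH M n hn hnM (fun m q => (-1) * (pt (vm m) q + U0 * px (vm m) q + py (pm m) q
      + f * um m q)) x y t (-(f * U0))]
    · ring
    · intro z hz
      have h := heq2 (x, y, z, t) hq ht hz
      rw [← cos_smul, ← cos_add, ← cos_add, ← cos_add, ← cos_smul, ← cos_smul,
        ← pT_cos dv, ← pX_cos dv, ← pY_cos dp]
      linarith
  · rw [proj_sin H hH M n hn hnM (fun m q => (-1) * (pt (ψm m) q + U0 * px (ψm m) q
      + N ^ 2 * wm m q)) x y t]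
    · rw [hw']; ring
    · intro z hz
      have h := heq3 (x, y, z, t) hq ht hz
      rw [← sin_smul, ← sin_add, ← sin_add, ← sin_smul, ← sin_smul,
        ← pT_sin dψ, ← pX_sin dψ]
      linarith
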